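/- (Theorem 3) Let γ ≠ 0, C > 0 be real constants and let Z(ρ,ψ) be a C³ solution of equation (5.11): ρ(ρ+1)Z_ρρ + ρZ_ρ + Z_ψψ = 0 on a domain A ⊂ {−1 < ρ < 0} ∪ {ρ > 0}, on which D = ρ(ρ+1)Z_ρρ² + (Z_ψ/ρ − Z_ρψ)² ≠ 0. Define the metric on A by ds² = (γ²(ρ+1)/(Cρ⁴))·[(ρ⁴Z_ρρ² + (ρZ_ρψ − Z_ψ)²)dρ² − 2ρ²Z_ρρ(ρZ_ρψ − Z_ψ)dρ dψ + ρ²(ρ²(ρ+1)²Z_ρρ² + (ρZ_ρψ − Z_ψ)²)dψ²], the magnetic field Ω(ρ,ψ) = (γ/2)Z_ρρ, the Hamiltonian H = (1/2)gⁱʲp_ip_j with (gⁱʲ) the inverse of the metric matrix, and the function F = (a₀p_ρ + a₁p_ψ + γD sin(ψ/2))/(b₀p_ρ + b₁p_ψ + γD cos(ψ/2)), where a₀ = ρZ_ρψ sin(ψ/2) + Z_ψψ cos(ψ/2) + ρZ_ρ cos(ψ/2) − Z_ψ sin(ψ/2), b₀ = ρZ_ρψ cos(ψ/2) − Z_ψψ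 sin(ψ/2) − ρZ_ρ sin(ψ/2) − Z_ψ cos(ψ/2), a₁ = −ρZ_ρρ sin(ψ/2) − Z_ρψ cos(ψ/2) + (1/ρ)Z_ψ cos(ψ/2), b₁ = −ρZ_ρρ cos(ψ/2) + Z_ρψ sin(ψ/2) − (1/ρ)Z_ψ sin(ψ/2). Then the magnetic Poisson bracket {F,H}_mg (with coordinates (ρ,ψ) and magnetic field Ω) vanishes at every point (ρ,ψ,p_ρ,p_ψ) with (ρ,ψ) ∈ A, H = C/2, and nonvanishing denominator of F. -/

import Mathlib

open Real

noncomputable section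

/-- Partial derivative in the first variable of a function on `ℝ²`. -/
def pdx (f : ℝ × ℝ → ℝ) (p : ℝ × ℝ) : ℝ := deriv (fun t => f (t, p.2)) p.1

/-- Partial derivative in the second variable of a function on `ℝ²`. -/
def pdy (f : ℝ × ℝ → ℝ) (p : ℝ × ℝ) : ℝ := deriv (fun t => f (p.1, t)) p.2

/-- The magnetic Poisson bracket of two functions `F`, `H` of `(ρ, ψ, p_ρ, p_ψ)` with
magnetic field `Ω(ρ,ψ)`. -/
def magneticBracket (Ω : ℝ → ℝ → ℝ) (F H : ℝ → ℝ → ℝ → ℝ → ℝ)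
    (ρ ψ pρ pψ : ℝ) : ℝ :=
  deriv (fun t => F t ψ pρ pψ) ρ * deriv (fun t => H ρ ψ t pψ) pρ
    - deriv (fun t => F ρ ψ t pψ) pρ * deriv (fun t => H t ψ pρ pψ) ρ
    + deriv (fun t => F ρ t pρ pψ) ψ * deriv (fun t => H ρ ψ pρ t) pψ
    - deriv (fun t => F ρ ψ pρ t) pψ * deriv (fun t => H ρ t pρ pψ) ψ
    + Ω ρ ψ * (deriv (fun t => F ρ ψ t pψ) pρ * deriv (fun t => H ρ ψ pρ t) pψ
      - deriv (fun t => F ρ ψ pρ t) pψ * deriv (fun t => H ρ ψ t pψ) pρ)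

/-- The quantity `D = ρ(ρ+1)Z_ρρ² + (Z_ψ/ρ − Z_ρψ)²`. -/
def Dfun (Z : ℝ × ℝ → ℝ) (q : ℝ × ℝ) : ℝ :=
  q.1 * (q.1 + 1) * (pdx (pdx Z) q) ^ 2 + (pdy Z q / q.1 - pdy (pdx Z) q) ^ 2

/-- The metric matrix `(g_{ij})` of the metric (5.18) in the coordinates `(ρ,ψ)`. -/
def gMatrix (γ C : ℝ) (Z : ℝ × ℝ → ℝ) (q : ℝ × ℝ) : Matrix (Fin 2) (Fin 2) ℝ :=
  let c := γ ^ 2 * (q.1 + 1) / (C * q.1 ^ 4)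
  !![c * (q.1 ^ 4 * (pdx (pdx Z) q) ^ 2 + (q.1 * pdy (pdx Z) q - pdy Z q) ^ 2),
     c * (-(q.1 ^ 2 * pdx (pdx Z) q * (q.1 * pdy (pdx Z) q - pdy Z q)));
     c * (-(q.1 ^ 2 * pdx (pdx Z) q * (q.1 * pdy (pdx Z) q - pdy Z q))),
     c * (q.1 ^ 2 * (q.1 ^ 2 * (q.1 + 1) ^ 2 * (pdx (pdx Z) q) ^ 2
       + (q.1 * pdy (pdx Z) q - pdy Z q) ^ 2))]

/-- The Hamiltonian `H = (1/2) gⁱʲ pᵢ pⱼ` of the metric (5.18), `(gⁱʲ)` being the inverse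
of the metric matrix. -/
def Hfun (γ C : ℝ) (Z : ℝ × ℝ → ℝ) (ρ ψ pρ pψ : ℝ) : ℝ :=
  (1 / 2) * ((gMatrix γ C Z (ρ, ψ))⁻¹ 0 0 * pρ ^ 2
    + 2 * (gMatrix γ C Z (ρ, ψ))⁻¹ 0 1 * pρ * pψ
    + (gMatrix γ C Z (ρ, ψ))⁻¹ 1 1 * pψ ^ 2)

def a₀fun (Z : ℝ × ℝ → ℝ) (q : ℝ × ℝ) : ℝ :=
  q.1 * pdy (pdx Z) q * Real.sin (q.2 / 2) + pdy (pdy Z) q * Real.cos (q.2 / 2)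
    + q.1 * pdx Z q * Real.cos (q.2 / 2) - pdy Z q * Real.sin (q.2 / 2)

def b₀fun (Z : ℝ × ℝ → ℝ) (q : ℝ × ℝ) : ℝ :=
  q.1 * pdy (pdx Z) q * Real.cos (q.2 / 2) - pdy (pdy Z) q * Real.sin (q.2 / 2)
    - q.1 * pdx Z q * Real.sin (q.2 / 2) - pdy Z q * Real.cos (q.2 / 2)

def a₁fun (Z : ℝ × ℝ → ℝ) (q : ℝ × ℝ) : ℝ :=
  -(q.1 * pdx (pdx Z) q * Real.sin (q.2 / 2)) - pdy (pdx Z) q * Real.cos (q.2 / 2)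
    + (1 / q.1) * pdy Z q * Real.cos (q.2 / 2)

def b₁fun (Z : ℝ × ℝ → ℝ) (q : ℝ × ℝ) : ℝ :=
  -(q.1 * pdx (pdx Z) q * Real.cos (q.2 / 2)) + pdy (pdx Z) q * Real.sin (q.2 / 2)
    - (1 / q.1) * pdy Z q * Real.sin (q.2 / 2)

/-- The rational in momenta function (5.20). -/
def Ffun (γ : ℝ) (Z : ℝ × ℝ → ℝ) (ρ ψ pρ pψ : ℝ) : ℝ :=
  (a₀fun Z (ρ, ψ) * pρ + a₁fun Z (ρ, ψ) * pψ + γ * Dfun Z (ρ, ψ) * Real.sin (ψ / 2)) /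
    (b₀fun Z (ρ, ψ) * pρ + b₁fun Z (ρ, ψ) * pψ + γ * Dfun Z (ρ, ψ) * Real.cos (ψ / 2))

lemma hasDerivAt_mk_left {f : ℝ × ℝ → ℝ} {q : ℝ × ℝ} (hf : DifferentiableAt ℝ f q) :
    HasDerivAt (fun t => f (t, q.2)) (fderiv ℝ f q (1, 0)) q.1 :=
  hf.hasFDerivAt.comp_hasDerivAt (f := fun t => (t, q.2)) q.1
    ((hasDerivAt_id q.1).prodMk (hasDerivAt_const q.1 q.2))

lemma hasDerivAt_mk_right {f : ℝ × ℝ → ℝ} {q : ℝ × ℝ} (hf : DifferentiableAt ℝ f q) :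
    HasDerivAt (fun t => f (q.1, t)) (fderiv ℝ f q (0, 1)) q.2 :=
  hf.hasFDerivAt.comp_hasDerivAt (f := fun t => (q.1, t)) q.2
    ((hasDerivAt_const q.2 q.1).prodMk (hasDerivAt_id q.2))

lemma pdx_eq_fderiv {f : ℝ × ℝ → ℝ} {q : ℝ × ℝ} (hf : DifferentiableAt ℝ f q) :
    pdx f q = fderiv ℝ f q (1, 0) :=
  (hasDerivAt_mk_left hf).deriv

lemma pdy_eq_fderiv {f : ℝ × ℝ → ℝ} {q : ℝ × ℝ} (hf : DifferentiableAt ℝ f q) :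
    pdy f q = fderiv ℝ f q (0, 1) :=
  (hasDerivAt_mk_right hf).deriv

lemma hasDerivAt_pdx {f : ℝ × ℝ → ℝ} {q : ℝ × ℝ} (hf : DifferentiableAt ℝ f q) :
    HasDerivAt (fun t => f (t, q.2)) (pdx f q) q.1 :=
  (hasDerivAt_mk_left hf).differentiableAt.hasDerivAt

lemma hasDerivAt_pdy {f : ℝ × ℝ → ℝ} {q : ℝ × ℝ} (hf : DifferentiableAt ℝ f q) :
    HasDerivAt (fun t => f (q.1, t)) (pdy f q) q.2 :=
  (hasDerivAt_mk_right hf).differentiableAt.hasDerivAt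

section Regularity

variable {A : Set (ℝ × ℝ)} {f : ℝ × ℝ → ℝ} {m n : WithTop ℕ∞}

lemma ContDiffOn.differentiableAt_of_isOpen (hf : ContDiffOn ℝ n f A) (hA : IsOpen A)
    (hn : n ≠ 0) {q : ℝ × ℝ} (hq : q ∈ A) : DifferentiableAt ℝ f q :=
  (hf.contDiffAt (hA.mem_nhds hq)).differentiableAt hn

lemma contDiffOn_pdx (hf : ContDiffOn ℝ n f A) (hA : IsOpen A) (hmn : m + 1 ≤ n) :
    ContDiffOn ℝ m (pdx f) A :=
  ((hf.fderiv_of_isOpen hA hmn).clm_apply contDiffOn_const).congr fun _ hq =>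
    pdx_eq_fderiv (hf.differentiableAt_of_isOpen hA
      (by rintro rfl; simp at hmn) hq)

lemma contDiffOn_pdy (hf : ContDiffOn ℝ n f A) (hA : IsOpen A) (hmn : m + 1 ≤ n) :
    ContDiffOn ℝ m (pdy f) A :=
  ((hf.fderiv_of_isOpen hA hmn).clm_apply contDiffOn_const).congr fun _ hq =>
    pdy_eq_fderiv (hf.differentiableAt_of_isOpen hA
      (by rintro rfl; simp at hmn) hq)

lemma eventually_mk_left {q : ℝ × ℝ} (hA : IsOpen A) (hq : q ∈ A) :
    ∀ᶠ t in nhds q.1, (t, q.2) ∈ A :=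
  (by fun_prop : Continuous fun t : ℝ => (t, q.2)).continuousAt.eventually (hA.mem_nhds hq)

lemma eventually_mk_right {q : ℝ × ℝ} (hA : IsOpen A) (hq : q ∈ A) :
    ∀ᶠ t in nhds q.2, (q.1, t) ∈ A :=
  (by fun_prop : Continuous fun t : ℝ => (q.1, t)).continuousAt.eventually (hA.mem_nhds hq)

lemma pdx_congr {g : ℝ × ℝ → ℝ} {q : ℝ × ℝ} (hA : IsOpen A) (hfg : Set.EqOn f g A)
    (hq : q ∈ A) : pdx f q = pdx g q :=
  Filter.EventuallyEq.deriv_eq ((eventually_mk_left hA hq).mono fun _ h => hfg h)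

lemma pdy_congr {g : ℝ × ℝ → ℝ} {q : ℝ × ℝ} (hA : IsOpen A) (hfg : Set.EqOn f g A)
    (hq : q ∈ A) : pdy f q = pdy g q :=
  Filter.EventuallyEq.deriv_eq ((eventually_mk_right hA hq).mono fun _ h => hfg h)

lemma pdx_pdy_comm (hf : ContDiffOn ℝ 2 f A) (hA : IsOpen A) {q : ℝ × ℝ} (hq : q ∈ A) :
    pdx (pdy f) q = pdy (pdx f) q := by
  have hd : ∀ p ∈ A, DifferentiableAt ℝ f p := fun p hp =>
    hf.differentiableAt_of_isOpen hA two_ne_zero hp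
  have hd' : DifferentiableAt ℝ (fderiv ℝ f) q :=
    ((hf.fderiv_of_isOpen hA (m := 1) (by norm_num)).contDiffAt
      (hA.mem_nhds hq)).differentiableAt one_ne_zero
  have key : ∀ v w : ℝ × ℝ,
      fderiv ℝ (fun p => fderiv ℝ f p v) q w = fderiv ℝ (fderiv ℝ f) q w v := by
    intro v w
    rw [fderiv_clm_apply hd' (differentiableAt_const v)]
    simp
  have hv : ∀ v : ℝ × ℝ, DifferentiableAt ℝ (fun p => fderiv ℝ f p v) q := fun v =>
    hd'.clm_apply (differentiableAt_const v)
  have hs : IsSymmSndFDerivAt ℝ f q :=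
    (hf.contDiffAt (hA.mem_nhds hq)).isSymmSndFDerivAt (by simp)
  rw [pdx_congr hA (fun p hp => pdy_eq_fderiv (hd p hp)) hq,
    pdy_congr hA (fun p hp => pdx_eq_fderiv (hd p hp)) hq,
    pdx_eq_fderiv (hv _), pdy_eq_fderiv (hv _), key, key]
  exact hs _ _

end Regularity

/-- `ρ(ρ+1)z² + u²`; this is `D` for `z = Z_ρρ` and `u = Z_ρψ − Z_ψ/ρ`. -/
def discr (r z u : ℝ) : ℝ := r * (r + 1) * z ^ 2 + u ^ 2

/-- With `momOne` and `momTwo` as momentum coordinates the kinetic energy is a multiple of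
`momOne² + momTwo²`. -/
def momOne (r z u p q : ℝ) : ℝ := r * u * p - r * z * q

/-- See `momOne`. -/
def momTwo (r z u p q : ℝ) : ℝ := -(r * (r + 1) * z * p) - u * q

def rotNum (γ r s z u p q : ℝ) : ℝ :=
  (momOne r z u p q + γ * discr r z u) * sin (s / 2) + momTwo r z u p q * cos (s / 2)

def rotDen (γ r s z u p q : ℝ) : ℝ :=
  (momOne r z u p q + γ * discr r z u) * cos (s / 2) - momTwo r z u p q * sin (s / 2)

def energy (γ C r z u p q : ℝ) : ℝ :=
  C / (2 * γ ^ 2) * ((momOne r z u p q ^ 2 + momTwo r z u p q ^ 2) /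
    ((r + 1) * discr r z u ^ 2))

section Curves

variable {r s z u p q : ℝ → ℝ} {r' s' z' u' p' q' t : ℝ}

lemma hasDerivAt_discr (hr : HasDerivAt r r' t) (hz : HasDerivAt z z' t)
    (hu : HasDerivAt u u' t) :
    HasDerivAt (fun t => discr (r t) (z t) (u t))
      ((2 * r t + 1) * r' * z t ^ 2 + 2 * r t * (r t + 1) * z t * z' + 2 * u t * u') t := by
  unfold discr
  exact (((hr.mul (hr.add_const 1)).mul (hz.pow 2)).add (hu.pow 2)).congr_deriv
    (by simp; ring)

lemma hasDerivAt_momOne (hr : HasDerivAt r r' t) (hz : HasDerivAt z z' t)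
    (hu : HasDerivAt u u' t) (hp : HasDerivAt p p' t) (hq : HasDerivAt q q' t) :
    HasDerivAt (fun t => momOne (r t) (z t) (u t) (p t) (q t))
      ((r' * u t + r t * u') * p t + r t * u t * p' - (r' * z t + r t * z') * q t
        - r t * z t * q') t := by
  unfold momOne
  exact (((hr.mul hu).mul hp).sub ((hr.mul hz).mul hq)).congr_deriv (by simp; ring)

lemma hasDerivAt_momTwo (hr : HasDerivAt r r' t) (hz : HasDerivAt z z' t)
    (hu : HasDerivAt u u' t) (hp : HasDerivAt p p' t) (hq : HasDerivAt q q' t) :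
    HasDerivAt (fun t => momTwo (r t) (z t) (u t) (p t) (q t))
      (-((2 * r t + 1) * r' * z t * p t + r t * (r t + 1) * z' * p t
        + r t * (r t + 1) * z t * p') - u' * q t - u t * q') t := by
  unfold momTwo
  exact (((((hr.mul (hr.add_const 1)).mul hz).mul hp).neg).sub (hu.mul hq)).congr_deriv
    (by simp; ring)

lemma hasDerivAt_rotated_quotient {X R : ℝ → ℝ} {X' R' : ℝ} (hX : HasDerivAt X X' t)
    (hR : HasDerivAt R R' t) (hs : HasDerivAt s s' t)
    (h0 : X t * cos (s t / 2) - R t * sin (s t / 2) ≠ 0) :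
    HasDerivAt (fun t => (X t * sin (s t / 2) + R t * cos (s t / 2)) /
        (X t * cos (s t / 2) - R t * sin (s t / 2)))
      ((X t * R' - R t * X' + (X t ^ 2 + R t ^ 2) / 2 * s') /
        (X t * cos (s t / 2) - R t * sin (s t / 2)) ^ 2) t := by
  have hsin := (hs.div_const 2).sin
  have hcos := (hs.div_const 2).cos
  refine (((hX.mul hsin).add (hR.mul hcos)).div ((hX.mul hcos).sub (hR.mul hsin))
    h0).congr_deriv ?_
  simp only [Pi.mul_apply, Pi.add_apply, Pi.sub_apply]
  congr 1
  linear_combination (X t * R' - R t * X' + (X t ^ 2 + R t ^ 2) / 2 * s') *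
    sin_sq_add_cos_sq (s t / 2)

lemma hasDerivAt_energy {γ C S' E' : ℝ} (hγ : γ ≠ 0)
    (hE : HasDerivAt (fun t => (r t + 1) * discr (r t) (z t) (u t) ^ 2) E' t)
    (hS : HasDerivAt (fun t => momOne (r t) (z t) (u t) (p t) (q t) ^ 2
      + momTwo (r t) (z t) (u t) (p t) (q t) ^ 2) S' t)
    (h0 : (r t + 1) * discr (r t) (z t) (u t) ^ 2 ≠ 0)
    (hlevel : momOne (r t) (z t) (u t) (p t) (q t) ^ 2
      + momTwo (r t) (z t) (u t) (p t) (q t) ^ 2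
      = γ ^ 2 * ((r t + 1) * discr (r t) (z t) (u t) ^ 2)) :
    HasDerivAt (fun t => energy γ C (r t) (z t) (u t) (p t) (q t))
      (C / (2 * γ ^ 2 * ((r t + 1) * discr (r t) (z t) (u t) ^ 2)) * (S' - γ ^ 2 * E')) t := by
  unfold energy
  refine ((hS.div hE h0).const_mul (C / (2 * γ ^ 2))).congr_deriv ?_
  rw [hlevel]
  field_simp

end Curves

/-- The vanishing of the bracket in terms of `(z, u) = (Z_ρρ, Z_ρψ − Z_ψ/ρ)`, whose
derivatives are related by `r u_r + u = r z_ψ` and `u_ψ = −r(2z + (r+1)z_r)`. -/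
lemma magneticBracket_rotNum_div_rotDen_energy {γ C r s p q zr zs ur us : ℝ} (hγ : γ ≠ 0)
    {z u : ℝ × ℝ → ℝ} (hr1 : r + 1 ≠ 0)
    (hzr : HasDerivAt (fun t => z (t, s)) zr r) (hzs : HasDerivAt (fun t => z (r, t)) zs s)
    (hur : HasDerivAt (fun t => u (t, s)) ur r) (hus : HasDerivAt (fun t => u (r, t)) us s)
    (hu : u (r, s) = r * (zs - ur)) (husz : us = -(r * (2 * z (r, s) + (r + 1) * zr)))
    (hD : discr r (z (r, s)) (u (r, s)) ≠ 0)
    (hlevel : momOne r (z (r, s)) (u (r, s)) p q ^ 2 + momTwo r (z (r, s)) (u (r, s)) p q ^ 2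
      = γ ^ 2 * ((r + 1) * discr r (z (r, s)) (u (r, s)) ^ 2))
    (hden : rotDen γ r s (z (r, s)) (u (r, s)) p q ≠ 0) :
    magneticBracket (fun r s => γ / 2 * z (r, s))
      (fun r s p q => rotNum γ r s (z (r, s)) (u (r, s)) p q /
        rotDen γ r s (z (r, s)) (u (r, s)) p q)
      (fun r s p q => energy γ C r (z (r, s)) (u (r, s)) p q) r s p q = 0 := by
  have h0 : (r + 1) * discr r (z (r, s)) (u (r, s)) ^ 2 ≠ 0 := mul_ne_zero hr1 (pow_ne_zero 2 hD)
  have main : ∀ {ρ σ ζ υ η κ : ℝ → ℝ} {ρ' σ' ζ' υ' η' κ' t : ℝ},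
      HasDerivAt ρ ρ' t → HasDerivAt σ σ' t → HasDerivAt ζ ζ' t → HasDerivAt υ υ' t →
      HasDerivAt η η' t → HasDerivAt κ κ' t →
      ρ t = r → σ t = s → ζ t = z (r, s) → υ t = u (r, s) → η t = p → κ t = q →
      ∃ P' R' D' : ℝ,
        P' = (ρ' * u (r, s) + r * υ') * p + r * u (r, s) * η' - (ρ' * z (r, s) + r * ζ') * q
          - r * z (r, s) * κ' ∧
        R' = -((2 * r + 1) * ρ' * z (r, s) * p + r * (r + 1) * ζ' * p
          + r * (r + 1) * z (r, s) * η') - υ' * q - u (r, s) * κ' ∧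
        D' = (2 * r + 1) * ρ' * z (r, s) ^ 2 + 2 * r * (r + 1) * z (r, s) * ζ'
          + 2 * u (r, s) * υ' ∧
        deriv (fun t => rotNum γ (ρ t) (σ t) (ζ t) (υ t) (η t) (κ t) /
          rotDen γ (ρ t) (σ t) (ζ t) (υ t) (η t) (κ t)) t =
          ((momOne r (z (r, s)) (u (r, s)) p q + γ * discr r (z (r, s)) (u (r, s))) * R'
            - momTwo r (z (r, s)) (u (r, s)) p q * (P' + γ * D')
            + ((momOne r (z (r, s)) (u (r, s)) p q + γ * discr r (z (r, s)) (u (r, s))) ^ 2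
              + momTwo r (z (r, s)) (u (r, s)) p q ^ 2) / 2 * σ') /
            rotDen γ r s (z (r, s)) (u (r, s)) p q ^ 2 ∧
        deriv (fun t => energy γ C (ρ t) (ζ t) (υ t) (η t) (κ t)) t =
          C / (2 * γ ^ 2 * ((r + 1) * discr r (z (r, s)) (u (r, s)) ^ 2)) *
            (2 * momOne r (z (r, s)) (u (r, s)) p q * P'
              + 2 * momTwo r (z (r, s)) (u (r, s)) p q * R'
              - γ ^ 2 * (ρ' * discr r (z (r, s)) (u (r, s)) ^ 2
                + (r + 1) * (2 * discr r (z (r, s)) (u (r, s)) * D'))) := by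
    intro ρ σ ζ υ η κ ρ' σ' ζ' υ' η' κ' t hρ hσ hζ hυ hη hκ eρ eσ eζ eυ eη eκ
    have dD := hasDerivAt_discr hρ hζ hυ
    have dP := hasDerivAt_momOne hρ hζ hυ hη hκ
    have dR := hasDerivAt_momTwo hρ hζ hυ hη hκ
    have dF := hasDerivAt_rotated_quotient (dP.add (dD.const_mul γ)) dR hσ
      (by simpa only [Pi.add_apply, eρ, eσ, eζ, eυ, eη, eκ, rotDen] using hden)
    have dE := (hρ.add_const 1).mul (dD.pow 2)
    have dS := (dP.pow 2).add (dR.pow 2)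
    have dH := hasDerivAt_energy (C := C) hγ dE dS
      (by simpa only [eρ, eζ, eυ] using h0) (by simpa only [eρ, eζ, eυ, eη, eκ] using hlevel)
    refine ⟨_, _, _, rfl, rfl, rfl, dF.deriv.trans ?_, dH.deriv.trans ?_⟩
    · simp only [Pi.add_apply, eρ, eσ, eζ, eυ, eη, eκ, rotDen]
    · simp only [Pi.pow_apply, eρ, eζ, eυ, eη, eκ]
      norm_num
  obtain ⟨P₁, R₁, D₁, hP₁, hR₁, hD₁, F₁, H₁⟩ := main (hasDerivAt_id' r) (hasDerivAt_const r s)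
    hzr hur (hasDerivAt_const r p) (hasDerivAt_const r q) rfl rfl rfl rfl rfl rfl
  obtain ⟨P₂, R₂, D₂, hP₂, hR₂, hD₂, F₂, H₂⟩ := main (hasDerivAt_const s r) (hasDerivAt_id' s)
    hzs hus (hasDerivAt_const s p) (hasDerivAt_const s q) rfl rfl rfl rfl rfl rfl
  obtain ⟨P₃, R₃, D₃, hP₃, hR₃, hD₃, F₃, H₃⟩ := main (hasDerivAt_const p r)
    (hasDerivAt_const p s) (hasDerivAt_const p (z (r, s))) (hasDerivAt_const p (u (r, s)))
    (hasDerivAt_id' p) (hasDerivAt_const p q) rfl rfl rfl rfl rfl rfl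
  obtain ⟨P₄, R₄, D₄, hP₄, hR₄, hD₄, F₄, H₄⟩ := main (hasDerivAt_const q r)
    (hasDerivAt_const q s) (hasDerivAt_const q (z (r, s))) (hasDerivAt_const q (u (r, s)))
    (hasDerivAt_const q p) (hasDerivAt_id' q) rfl rfl rfl rfl rfl rfl
  unfold magneticBracket
  rw [F₁, F₂, F₃, F₄, H₁, H₂, H₃, H₄]
  generalize rotDen γ r s (z (r, s)) (u (r, s)) p q ^ 2 = W
  generalize C / (2 * γ ^ 2 * ((r + 1) * discr r (z (r, s)) (u (r, s)) ^ 2)) = K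
  clear F₁ F₂ F₃ F₄ H₁ H₂ H₃ H₄ main hzr hzs hur hus hden h0 hD
  simp only [hP₁, hR₁, hD₁, hP₂, hR₂, hD₂, hP₃, hR₃, hD₃, hP₄, hR₄, hD₄]
  clear hP₁ hR₁ hD₁ hP₂ hR₂ hD₂ hP₃ hR₃ hD₃ hP₄ hR₄ hD₄
  unfold momOne momTwo discr at *
  rw [hu] at hlevel
  rw [hu, husz]
  generalize z (r, s) = z at *
  obtain ⟨k, rfl⟩ : ∃ k, ur = zs - k := ⟨zs - ur, by ring⟩
  linear_combination (K / W) *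
    (-4 * r ^ 4 * p * k * zr + 4 * r ^ 4 * γ * z ^ 2 * zr - 4 * r ^ 4 * γ * k ^ 2 * zr
      - 8 * r ^ 3 * p * z * k + 4 * r ^ 3 * p * z * zs - 4 * r ^ 3 * p * k * zr
      - 4 * r ^ 3 * q * z * zr + 5 * r ^ 3 * γ * z ^ 3 + 8 * r ^ 3 * γ * z ^ 2 * zr
      - 11 * r ^ 3 * γ * z * k ^ 2 + 8 * r ^ 3 * γ * z * k * zs - 4 * r ^ 3 * γ * k ^ 2 * zr
      - r ^ 2 * p * z * k + 4 * r ^ 2 * p * z * zs - 5 * r ^ 2 * q * z ^ 2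
      - 4 * r ^ 2 * q * z * zr + 3 * r ^ 2 * q * k ^ 2 - 4 * r ^ 2 * q * k * zs
      + 7 * r ^ 2 * γ * z ^ 3 + 4 * r ^ 2 * γ * z ^ 2 * zr - 4 * r ^ 2 * γ * z * k ^ 2
      + 8 * r ^ 2 * γ * z * k * zs - 2 * r * q * z ^ 2 + 2 * r * γ * z ^ 3) * hlevel

lemma inv_gMatrix {γ C : ℝ} (hγ : γ ≠ 0) (hC : C ≠ 0) {Z : ℝ × ℝ → ℝ} {q : ℝ × ℝ}
    (h0 : q.1 ≠ 0) (h1 : q.1 + 1 ≠ 0) (hD : Dfun Z q ≠ 0) :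
    (gMatrix γ C Z q)⁻¹ =
      (C / (γ ^ 2 * (q.1 + 1) * Dfun Z q ^ 2)) •
      !![q.1 ^ 2 * (q.1 + 1) ^ 2 * pdx (pdx Z) q ^ 2 + (q.1 * pdy (pdx Z) q - pdy Z q) ^ 2,
        pdx (pdx Z) q * (q.1 * pdy (pdx Z) q - pdy Z q);
        pdx (pdx Z) q * (q.1 * pdy (pdx Z) q - pdy Z q),
        (q.1 ^ 4 * pdx (pdx Z) q ^ 2 + (q.1 * pdy (pdx Z) q - pdy Z q) ^ 2) / q.1 ^ 2] := by
  refine Matrix.inv_eq_right_inv ?_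
  have hD' : q.1 ^ 2 * Dfun Z q =
      q.1 ^ 3 * (q.1 + 1) * pdx (pdx Z) q ^ 2 + (q.1 * pdy (pdx Z) q - pdy Z q) ^ 2 := by
    unfold Dfun
    field_simp
    ring
  unfold gMatrix
  generalize Dfun Z q = D at *
  generalize q.1 * pdy (pdx Z) q - pdy Z q = u at *
  generalize pdx (pdx Z) q = z at *
  have hD2 : q.1 ^ 4 * D ^ 2 = (q.1 ^ 3 * (q.1 + 1) * z ^ 2 + u ^ 2) ^ 2 := by
    rw [← hD']
    ring
  ext i j
  fin_cases i <;> fin_cases j <;>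
    simp [Matrix.mul_apply, Fin.sum_univ_two] <;> field_simp
  · linear_combination -hD2
  · ring
  · ring
  · linear_combination -hD2

lemma dfun_eq_discr (Z : ℝ × ℝ → ℝ) (q : ℝ × ℝ) :
    Dfun Z q = discr q.1 (pdx (pdx Z) q) (pdy (pdx Z) q - pdy Z q / q.1) := by
  unfold Dfun discr
  ring

lemma hfun_eq_energy {γ C : ℝ} (hγ : γ ≠ 0) (hC : C ≠ 0) {Z : ℝ × ℝ → ℝ} {r s : ℝ}
    (h0 : r ≠ 0) (h1 : r + 1 ≠ 0) (hD : Dfun Z (r, s) ≠ 0) (p q : ℝ) :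
    Hfun γ C Z r s p q = energy γ C r (pdx (pdx Z) (r, s))
      (pdy (pdx Z) (r, s) - pdy Z (r, s) / r) p q := by
  unfold Hfun energy
  rw [inv_gMatrix hγ hC h0 h1 hD, ← dfun_eq_discr Z (r, s)]
  unfold momOne momTwo
  simp
  field_simp
  ring

lemma numerator_eq_rotNum {γ : ℝ} {Z : ℝ × ℝ → ℝ} {r s : ℝ} (h0 : r ≠ 0)
    (h511 : r * (r + 1) * pdx (pdx Z) (r, s) + r * pdx Z (r, s) + pdy (pdy Z) (r, s) = 0)
    (p q : ℝ) :
    a₀fun Z (r, s) * p + a₁fun Z (r, s) * q + γ * Dfun Z (r, s) * sin (s / 2) =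
      rotNum γ r s (pdx (pdx Z) (r, s)) (pdy (pdx Z) (r, s) - pdy Z (r, s) / r) p q := by
  rw [dfun_eq_discr]
  unfold a₀fun a₁fun rotNum momOne momTwo
  field_simp
  linear_combination r * p * cos (s / 2) * h511

lemma denominator_eq_rotDen {γ : ℝ} {Z : ℝ × ℝ → ℝ} {r s : ℝ} (h0 : r ≠ 0)
    (h511 : r * (r + 1) * pdx (pdx Z) (r, s) + r * pdx Z (r, s) + pdy (pdy Z) (r, s) = 0)
    (p q : ℝ) :
    b₀fun Z (r, s) * p + b₁fun Z (r, s) * q + γ * Dfun Z (r, s) * cos (s / 2) =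
      rotDen γ r s (pdx (pdx Z) (r, s)) (pdy (pdx Z) (r, s) - pdy Z (r, s) / r) p q := by
  rw [dfun_eq_discr]
  unfold b₀fun b₁fun rotDen momOne momTwo
  field_simp
  linear_combination -r * p * sin (s / 2) * h511

lemma ffun_eq_rotNum_div_rotDen {γ : ℝ} {Z : ℝ × ℝ → ℝ} {r s : ℝ} (h0 : r ≠ 0)
    (h511 : r * (r + 1) * pdx (pdx Z) (r, s) + r * pdx Z (r, s) + pdy (pdy Z) (r, s) = 0)
    (p q : ℝ) :
    Ffun γ Z r s p q =
      rotNum γ r s (pdx (pdx Z) (r, s)) (pdy (pdx Z) (r, s) - pdy Z (r, s) / r) p q /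
      rotDen γ r s (pdx (pdx Z) (r, s)) (pdy (pdx Z) (r, s) - pdy Z (r, s) / r) p q := by
  rw [← numerator_eq_rotNum h0 h511, ← denominator_eq_rotDen h0 h511]
  rfl

lemma magneticBracket_congr {A : Set (ℝ × ℝ)} (hA : IsOpen A) {Ω : ℝ → ℝ → ℝ}
    {F F' H H' : ℝ → ℝ → ℝ → ℝ → ℝ}
    (hF : ∀ r s, (r, s) ∈ A → ∀ p q, F r s p q = F' r s p q)
    (hH : ∀ r s, (r, s) ∈ A → ∀ p q, H r s p q = H' r s p q)
    {r s : ℝ} (hrs : (r, s) ∈ A) (p q : ℝ) :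
    magneticBracket Ω F H r s p q = magneticBracket Ω F' H' r s p q := by
  have key : ∀ G G' : ℝ → ℝ → ℝ → ℝ → ℝ,
      (∀ r s, (r, s) ∈ A → ∀ p q, G r s p q = G' r s p q) →
      deriv (fun t => G t s p q) r = deriv (fun t => G' t s p q) r ∧
      deriv (fun t => G r t p q) s = deriv (fun t => G' r t p q) s ∧
      deriv (fun t => G r s t q) p = deriv (fun t => G' r s t q) p ∧
      deriv (fun t => G r s p t) q = deriv (fun t => G' r s p t) q := by
    intro G G' hG
    refine ⟨Filter.EventuallyEq.deriv_eq ?_, Filter.EventuallyEq.deriv_eq ?_, ?_, ?_⟩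
    · exact (eventually_mk_left hA hrs).mono fun t ht => hG t s ht p q
    · exact (eventually_mk_right hA hrs).mono fun t ht => hG r t ht p q
    · simp only [hG r s hrs]
    · simp only [hG r s hrs]
  obtain ⟨f₁, f₂, f₃, f₄⟩ := key F F' hF
  obtain ⟨h₁, h₂, h₃, h₄⟩ := key H H' hH
  unfold magneticBracket
  rw [f₁, f₂, f₃, f₄, h₁, h₂, h₃, h₄]

lemma energy_eq_half_iff {γ C r z u p q : ℝ} (hγ : γ ≠ 0) (hC : C ≠ 0) (hr1 : r + 1 ≠ 0)
    (hD : discr r z u ≠ 0) :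
    energy γ C r z u p q = C / 2 ↔
      momOne r z u p q ^ 2 + momTwo r z u p q ^ 2 = γ ^ 2 * ((r + 1) * discr r z u ^ 2) := by
  unfold energy
  field_simp

/-- Theorem 3 of the paper. For a `C³` solution `Z` of equation (5.11)
on a domain `A ⊂ {−1 < ρ < 0} ∪ {ρ > 0}` with `D ≠ 0` on `A`, the geodesic flow of the
metric (5.18) in the magnetic field `Ω = (γ/2)Z_ρρ` admits the rational integral (5.20)
at the energy level `{H = C/2}`: the magnetic Poisson bracket `{F,H}_mg` vanishes at every
point of this level set with nonvanishing denominator of `F`. -/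
theorem statement13 (γ C : ℝ) (hγ : γ ≠ 0) (hC : 0 < C)
    (A : Set (ℝ × ℝ)) (hAopen : IsOpen A)
    (hA : A ⊆ {q : ℝ × ℝ | (-1 < q.1 ∧ q.1 < 0) ∨ 0 < q.1})
    (Z : ℝ × ℝ → ℝ) (hZ : ContDiffOn ℝ 3 Z A)
    (h511 : ∀ q ∈ A,
      q.1 * (q.1 + 1) * pdx (pdx Z) q + q.1 * pdx Z q + pdy (pdy Z) q = 0)
    (hD : ∀ q ∈ A, Dfun Z q ≠ 0) :
    ∀ ρ ψ pρ pψ : ℝ, (ρ, ψ) ∈ A →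
      Hfun γ C Z ρ ψ pρ pψ = C / 2 →
      b₀fun Z (ρ, ψ) * pρ + b₁fun Z (ρ, ψ) * pψ + γ * Dfun Z (ρ, ψ) * Real.cos (ψ / 2) ≠ 0 →
      magneticBracket (fun ρ ψ => (γ / 2) * pdx (pdx Z) (ρ, ψ))
        (Ffun γ Z) (Hfun γ C Z) ρ ψ pρ pψ = 0 := by
  intro ρ ψ pρ pψ hq hH hden
  have h0 : ∀ q ∈ A, q.1 ≠ 0 := fun q hq => by
    rcases hA hq with h | h
    exacts [h.2.ne, ne_of_gt h]
  have h1 : ∀ q ∈ A, q.1 + 1 ≠ 0 := fun q hq => by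
    rcases hA hq with h | h
    exacts [by linarith [h.1], by have : 0 < q.1 := h; positivity]
  have hx : ContDiffOn ℝ 2 (pdx Z) A := contDiffOn_pdx hZ hAopen (by norm_num)
  have hy : ContDiffOn ℝ 2 (pdy Z) A := contDiffOn_pdy hZ hAopen (by norm_num)
  have dx : DifferentiableAt ℝ (pdx Z) (ρ, ψ) :=
    hx.differentiableAt_of_isOpen hAopen two_ne_zero hq
  have dy : DifferentiableAt ℝ (pdy Z) (ρ, ψ) :=
    hy.differentiableAt_of_isOpen hAopen two_ne_zero hq
  have dxx : DifferentiableAt ℝ (pdx (pdx Z)) (ρ, ψ) :=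
    (contDiffOn_pdx (m := 1) hx hAopen (by norm_num)).differentiableAt_of_isOpen hAopen
      one_ne_zero hq
  have dxy : DifferentiableAt ℝ (pdy (pdx Z)) (ρ, ψ) :=
    (contDiffOn_pdy (m := 1) hx hAopen (by norm_num)).differentiableAt_of_isOpen hAopen
      one_ne_zero hq
  have hcomm : Set.EqOn (pdx (pdy Z)) (pdy (pdx Z)) A := fun q hq =>
    pdx_pdy_comm (hZ.of_le (by norm_num)) hAopen hq
  have hxyx : pdx (pdy (pdx Z)) (ρ, ψ) = pdy (pdx (pdx Z)) (ρ, ψ) :=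
    pdx_pdy_comm hx hAopen hq
  have hxyy : pdy (pdy (pdx Z)) (ρ, ψ) = -((2 * ρ + 1) * pdx (pdx Z) (ρ, ψ)
      + ρ * (ρ + 1) * pdx (pdx (pdx Z)) (ρ, ψ) + pdx Z (ρ, ψ) + ρ * pdx (pdx Z) (ρ, ψ)) := by
    rw [← pdy_congr hAopen hcomm hq, ← pdx_pdy_comm hy hAopen hq,
      pdx_congr hAopen (g := fun q => -(q.1 * (q.1 + 1) * pdx (pdx Z) q + q.1 * pdx Z q))
        (fun q hq => by linear_combination h511 q hq) hq]
    refine HasDerivAt.deriv (HasDerivAt.congr_deriv (((((hasDerivAt_id' ρ).mul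
      ((hasDerivAt_id' ρ).add_const 1)).mul (hasDerivAt_pdx dxx)).add
      ((hasDerivAt_id' ρ).mul (hasDerivAt_pdx dx))).neg) ?_)
    simp
    ring
  have hρ : ρ ≠ 0 := h0 _ hq
  have hρ1 : ρ + 1 ≠ 0 := h1 _ hq
  have hdisc := hD _ hq
  rw [dfun_eq_discr] at hdisc
  rw [hfun_eq_energy hγ hC.ne' hρ hρ1 (hD _ hq),
    energy_eq_half_iff hγ hC.ne' hρ1 hdisc] at hH
  rw [denominator_eq_rotDen hρ (h511 _ hq)] at hden
  rw [magneticBracket_congr hAopen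
    (fun r s hrs => ffun_eq_rotNum_div_rotDen (h0 _ hrs) (h511 _ hrs))
    (fun r s hrs => hfun_eq_energy hγ hC.ne' (h0 _ hrs) (h1 _ hrs) (hD _ hrs)) hq]
  refine magneticBracket_rotNum_div_rotDen_energy (z := pdx (pdx Z))
    (u := fun q => pdy (pdx Z) q - pdy Z q / q.1) hγ hρ1 (hasDerivAt_pdx dxx)
    (hasDerivAt_pdy dxx)
    ((hasDerivAt_pdx dxy).sub ((hasDerivAt_pdx dy).div (hasDerivAt_id' ρ) hρ))
    ((hasDerivAt_pdy dxy).sub ((hasDerivAt_pdy dy).div_const ρ)) ?_ ?_ hdisc hH hden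
  · rw [hxyx, hcomm hq]
    field_simp
    ring
  · rw [hxyy]
    field_simp
    linear_combination -h511 _ hq

end
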